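/- arXiv:1507.00615 — 8 statements merged into one kernel-verified Lean document; each statement's English description precedes it below -/
import Mathlib

section
/- Let G = SL₂(ℝ), let N be the subgroup of all matrices [[1, b],[0, 1]] with b ∈ ℝ, and let M = { [[x+y, z],[z, x−y]] : y, z ∈ ℝ, x ≥ 1, x² − y² − z² = 1 } ⊆ SL₂(ℝ). Then there is no continuous section σ : G/N → G (i.e. continuous with σ(gN) ∈ gN for all g ∈ G) whose image contains M. -/
open Matrix

/-- `SL₂(ℝ)` carries the subspace topology induced from the space of matrices. -/
noncomputable instance : TopologicalSpace (SpecialLinearGroup (Fin 2) ℝ) :=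
  TopologicalSpace.induced (fun g => (g : Matrix (Fin 2) (Fin 2) ℝ)) inferInstance

/-- A path of matrices whose first column is `(t, 1)`. -/
def columnPath (t : ℝ) : SpecialLinearGroup (Fin 2) ℝ :=
  ⟨!![t, -1; 1, 0], by simp [Matrix.det_fin_two]⟩

theorem continuous_columnPath : Continuous columnPath := by
  refine continuous_induced_rng.2 (continuous_matrix fun i j => ?_)
  fin_cases i <;> fin_cases j <;> simp [columnPath] <;> fun_prop

/-- The symmetric matrix of determinant one with first column `(t, 1)`. -/
noncomputable def symmetricPoint (t : ℝ) (ht : t ≠ 0) : SpecialLinearGroup (Fin 2) ℝ :=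
  ⟨!![t, 1; 1, 2 / t], by rw [Matrix.det_fin_two_of]; field_simp; norm_num⟩

theorem coe_columnPath_inv_mul_symmetricPoint (t : ℝ) (ht : t ≠ 0) :
    (((columnPath t)⁻¹ * symmetricPoint t ht : Matrix.SpecialLinearGroup (Fin 2) ℝ) :
      Matrix (Fin 2) (Fin 2) ℝ) = !![1, 2 / t; 0, 1] := by
  rw [Matrix.SpecialLinearGroup.coe_mul, Matrix.SpecialLinearGroup.coe_inv]
  ext i j
  fin_cases i <;> fin_cases j <;>
    simp [columnPath, symmetricPoint, Matrix.adjugate_fin_two, Matrix.mul_apply]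
  rw [mul_div_cancel₀ _ ht]
  norm_num

theorem symmetricPoint_mem_hyperboloid {t : ℝ} (ht : 0 < t) :
    ∃ x y z : ℝ, 1 ≤ x ∧ x ^ 2 - y ^ 2 - z ^ 2 = 1 ∧
      (symmetricPoint t ht.ne' : Matrix (Fin 2) (Fin 2) ℝ) = !![x + y, z; z, x - y] := by
  refine ⟨(t + 2 / t) / 2, (t - 2 / t) / 2, 1, ?_, ?_, ?_⟩
  · have h : t + 2 / t = (t ^ 2 + 2) / t := by field_simp
    rw [h, div_div, le_div_iff₀ (by positivity)]
    nlinarith [sq_nonneg (t - 1)]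
  · field_simp
    ring
  · ext i j
    fin_cases i <;> fin_cases j <;> simp [symmetricPoint] <;> ring

/-- Lemma 7 (case `l = 1`): there is no continuous section of `SL₂(ℝ)` by the
unipotent subgroup `N` whose image contains the hyperboloid manifold `M`. -/
theorem no_continuous_section_unipotent
    (N : Subgroup (SpecialLinearGroup (Fin 2) ℝ))
    (hN : ∀ g : SpecialLinearGroup (Fin 2) ℝ,
      g ∈ N ↔ ∃ b : ℝ, (g : Matrix (Fin 2) (Fin 2) ℝ) = !![1, b; 0, 1]) :
    ¬ ∃ σ : (SpecialLinearGroup (Fin 2) ℝ ⧸ N) → SpecialLinearGroup (Fin 2) ℝ,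
      Continuous σ ∧
      (∀ g : SpecialLinearGroup (Fin 2) ℝ,
        (QuotientGroup.mk (σ (QuotientGroup.mk g)) : SpecialLinearGroup (Fin 2) ℝ ⧸ N) =
          QuotientGroup.mk g) ∧
      {A : SpecialLinearGroup (Fin 2) ℝ | ∃ x y z : ℝ, 1 ≤ x ∧ x ^ 2 - y ^ 2 - z ^ 2 = 1 ∧
        (A : Matrix (Fin 2) (Fin 2) ℝ) = !![x + y, z; z, x - y]} ⊆ Set.range σ := by
  rintro ⟨σ, hσ, hsec, hM⟩
  have key : ∀ t : ℝ, ∀ ht : 0 < t,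
      σ (QuotientGroup.mk (columnPath t)) = symmetricPoint t ht.ne' := by
    intro t ht
    obtain ⟨c, hc⟩ := hM (symmetricPoint_mem_hyperboloid ht)
    obtain ⟨g, rfl⟩ := QuotientGroup.mk_surjective c
    have hg := hsec g
    rw [hc] at hg
    have hcol : (QuotientGroup.mk (columnPath t) : SpecialLinearGroup (Fin 2) ℝ ⧸ N) =
        QuotientGroup.mk (symmetricPoint t ht.ne') :=
      QuotientGroup.eq.2 ((hN _).2 ⟨_, coe_columnPath_inv_mul_symmetricPoint t ht.ne'⟩)
    rw [hcol, hg, hc]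
  have hf : Continuous fun t : ℝ =>
      (σ (QuotientGroup.mk (columnPath t)) : Matrix (Fin 2) (Fin 2) ℝ) 1 1 * t :=
    ((continuous_induced_dom.comp
      (hσ.comp (continuous_quot_mk.comp continuous_columnPath))).matrix_elem 1 1).mul continuous_id
  have h0 := (hf.tendsto 0).mono_left (nhdsWithin_le_nhds (s := Set.Ioi 0))
  have h2 := h0.congr' (f₂ := fun _ => (2 : ℝ)) <| by
    filter_upwards [self_mem_nhdsWithin] with t ht
    have ht' : t ≠ 0 := ne_of_gt ht
    rw [key t ht]
    simp [symmetricPoint, ht']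
  have h := tendsto_nhds_unique h2 tendsto_const_nhds
  norm_num at h
end

section
/- Let G = SL₂(ℝ), let B be the subgroup of all matrices [[l, b],[0, l⁻¹]] with l > 0 and b ∈ ℝ, and let M = { [[x+y, z],[z, x−y]] : y, z ∈ ℝ, x ≥ 1, x² − y² − z² = 1 } ⊆ SL₂(ℝ). Then there is no continuous section σ : G/B → G (i.e. continuous with σ(gB) ∈ gB for all g ∈ G) whose image contains M. -/
open Matrix

/-- The image of a section of `G` by `H` meets each left coset of `H` in at most one point. -/
theorem eq_of_mem_range_of_section {G : Type*} [Group G] {H : Subgroup G} {σ : G ⧸ H → G}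
    (hσ : ∀ g : G, (QuotientGroup.mk (σ (QuotientGroup.mk g)) : G ⧸ H) = QuotientGroup.mk g)
    {a b : G} (ha : a ∈ Set.range σ) (hb : b ∈ Set.range σ)
    (hab : (QuotientGroup.mk a : G ⧸ H) = QuotientGroup.mk b) : a = b := by
  obtain ⟨p, rfl⟩ := ha
  obtain ⟨q, rfl⟩ := hb
  obtain ⟨g, rfl⟩ := QuotientGroup.mk_surjective p
  obtain ⟨h, rfl⟩ := QuotientGroup.mk_surjective q
  rw [hσ, hσ] at hab
  rw [hab]

/-- Lemma 7 (case `0 < l`): there is no continuous section of `SL₂(ℝ)` by the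
Borel subgroup `B` whose image contains the hyperboloid manifold `M`. -/
theorem no_continuous_section_borel
    (B : Subgroup (SpecialLinearGroup (Fin 2) ℝ))
    (hB : ∀ g : SpecialLinearGroup (Fin 2) ℝ,
      g ∈ B ↔ ∃ l b : ℝ, 0 < l ∧ (g : Matrix (Fin 2) (Fin 2) ℝ) = !![l, b; 0, l⁻¹]) :
    ¬ ∃ σ : (SpecialLinearGroup (Fin 2) ℝ ⧸ B) → SpecialLinearGroup (Fin 2) ℝ,
      Continuous σ ∧
      (∀ g : SpecialLinearGroup (Fin 2) ℝ,
        (QuotientGroup.mk (σ (QuotientGroup.mk g)) : SpecialLinearGroup (Fin 2) ℝ ⧸ B) =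
          QuotientGroup.mk g) ∧
      {A : SpecialLinearGroup (Fin 2) ℝ | ∃ x y z : ℝ, 1 ≤ x ∧ x ^ 2 - y ^ 2 - z ^ 2 = 1 ∧
        (A : Matrix (Fin 2) (Fin 2) ℝ) = !![x + y, z; z, x - y]} ⊆ Set.range σ := by
  rintro ⟨σ, -, hσ, hM⟩
  let D : SpecialLinearGroup (Fin 2) ℝ := ⟨!![2, 0; 0, 2⁻¹], by simp [det_fin_two]⟩
  have hD : D ∈ B := (hB D).2 ⟨2, 0, two_pos, rfl⟩
  have h_one : (1 : SpecialLinearGroup (Fin 2) ℝ) ∈ Set.range σ :=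
    hM ⟨1, 0, 0, le_rfl, by norm_num, by simp [one_fin_two]⟩
  have h_diag : D ∈ Set.range σ :=
    hM ⟨5 / 4, 3 / 4, 0, by norm_num, by norm_num, by
      change !![(2 : ℝ), 0; 0, 2⁻¹] = _
      norm_num⟩
  have h_eq : 1 = D :=
    eq_of_mem_range_of_section hσ h_one h_diag (QuotientGroup.eq.2 (by simpa using hD))
  have h_entry : (1 : ℝ) = 2 :=
    congrArg (fun g : SpecialLinearGroup (Fin 2) ℝ => (g : Matrix (Fin 2) (Fin 2) ℝ) 0 0) h_eq
  norm_num at h_entry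
end

section
/- Let N be the subgroup of SL₂(ℝ) of all matrices [[1, b],[0, 1]] with b ∈ ℝ, and let M = { [[x+y, z],[z, x−y]] : y, z ∈ ℝ, x ≥ 1, x² − y² − z² = 1 } ⊆ SL₂(ℝ). For every real c > −1 set g(c) = [[1+c, 1],[c, 1]] and s(c) = [[1+c, c],[c, (c²+1)/(1+c)]]. Then the intersection of M with the left coset g(c)·N is exactly the one-element set {s(c)}. -/
open Matrix

/-- Intermediate claim in the proof of Lemma 7: for `c > -1` the intersection of the
hyperboloid manifold `M` with the left coset `g(c)·N` of the unipotent subgroup `N`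
is exactly `{s(c)}`. -/
theorem coset_meets_hyperboloid_in_one_point (c : ℝ) (hc : -1 < c) :
    {A : Matrix (Fin 2) (Fin 2) ℝ |
      (∃ x y z : ℝ, 1 ≤ x ∧ x ^ 2 - y ^ 2 - z ^ 2 = 1 ∧ A = !![x + y, z; z, x - y]) ∧
      (∃ b : ℝ, A = !![1 + c, 1; c, 1] * !![1, b; 0, 1])} =
    {!![1 + c, c; c, (c ^ 2 + 1) / (1 + c)]} := by
  have hpos : 0 < 1 + c := by linarith
  have h : 1 + c ≠ 0 := hpos.ne'
  ext A
  simp only [Set.mem_ofPred_eq, Set.mem_singleton_iff]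
  constructor
  · rintro ⟨⟨x, y, z, -, -, hM⟩, b, hN⟩
    have h01 : z = (1 + c) * b + 1 := by
      simpa [hM, Matrix.mul_apply] using congrFun (congrFun hN 0) 1
    have h10 : z = c := by
      simpa [hM, Matrix.mul_apply] using congrFun (congrFun hN 1) 0
    have hb : b = (c - 1) / (1 + c) := by
      rw [eq_div_iff h]
      linarith
    rw [hN, hb]
    ext i j
    fin_cases i <;> fin_cases j <;> simp [Matrix.mul_apply] <;> field_simp <;> ring
  · rintro rfl
    refine ⟨⟨(1 + c + (c ^ 2 + 1) / (1 + c)) / 2, (1 + c - (c ^ 2 + 1) / (1 + c)) / 2, c,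
      ?_, ?_, ?_⟩, (c - 1) / (1 + c), ?_⟩
    · have : 1 - c ≤ (c ^ 2 + 1) / (1 + c) := by
        rw [le_div_iff₀ hpos]
        nlinarith [sq_nonneg c]
      linarith
    · field_simp
      ring
    · ext i j
      fin_cases i <;> fin_cases j <;> simp <;> ring
    · ext i j
      fin_cases i <;> fin_cases j <;> simp [Matrix.mul_apply] <;> field_simp <;> ring
end

section
/- If r and s are symmetric positive-definite real n×n matrices with det r = 1 and det s = 1, then r·s·r is also a symmetric positive-definite real matrix with det(r·s·r) = 1. -/
open Matrix

/-- If `r`, `s` are symmetric positive-definite real matrices of determinant `1`,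
then so is `r·s·r` (closure condition for the Bol loop section of `SLₙ(ℝ)` by `SOₙ(ℝ)`). -/
theorem posdef_det_one_closed_under_rsr {n : ℕ} (r s : Matrix (Fin n) (Fin n) ℝ)
    (hrs : r.IsSymm) (hrp : r.PosDef) (hrd : r.det = 1)
    (hss : s.IsSymm) (hsp : s.PosDef) (hsd : s.det = 1) :
    (r * s * r).IsSymm ∧ (r * s * r).PosDef ∧ (r * s * r).det = 1 := by
  refine ⟨?_, ?_, ?_⟩
  · simp [Matrix.IsSymm, transpose_mul, hrs.eq, hss.eq, mul_assoc]
  · have h := hsp.conjTranspose_mul_mul_same (mulVec_injective_of_isUnit hrp.isUnit)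
    rwa [hrp.isHermitian.eq] at h
  · simp [hrd, hsd]
end

section
/- If r and s are Hermitian positive-definite complex n×n matrices with det r = 1 and det s = 1, then r·s·r is also a Hermitian positive-definite complex matrix with det(r·s·r) = 1. -/
open Matrix
open scoped ComplexOrder

/-- If `r`, `s` are Hermitian positive-definite complex matrices of determinant `1`,
then so is `r·s·r` (closure condition for the Bol loop section of `SLₙ(ℂ)` by `SU(n)`). -/
theorem hermitian_posdef_det_one_closed_under_rsr {n : ℕ} (r s : Matrix (Fin n) (Fin n) ℂ)
    (hrh : r.IsHermitian) (hrp : r.PosDef) (hrd : r.det = 1)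
    (hsh : s.IsHermitian) (hsp : s.PosDef) (hsd : s.det = 1) :
    (r * s * r).IsHermitian ∧ (r * s * r).PosDef ∧ (r * s * r).det = 1 := by
  have h : (r * s * r).PosDef := by
    simpa only [hrh.eq] using
      hsp.conjTranspose_mul_mul_same (mulVec_injective_of_isUnit hrp.isUnit)
  exact ⟨h.isHermitian, h, by rw [det_mul, det_mul, hrd, hsd, one_mul, one_mul]⟩
end

section
/- Let H₂ be the subgroup of SL₃(ℝ) of the previous statement for a fixed d > 1, i.e. all matrices with rows (d^{−2t}, a, b), (0, d^t cos t, d^t sin t), (0, −d^t sin t, d^t cos t) for t, a, b ∈ ℝ. Then there is no section σ : SL₃(ℝ)/H₂ → SL₃(ℝ) (i.e. no map with σ(gH₂) ∈ gH₂ for all g) whose image contains the set of all symmetric positive-definite real 3×3 matrices of determinant 1. -/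
open Matrix Real

/-- Proposition 12, part `H₂`: there is no section of `SL₃(ℝ)` by the subgroup `H₂`
whose image contains all symmetric positive-definite determinant-`1` matrices. -/
theorem no_section_H2 (d : ℝ) (hd : 1 < d)
    (H₂ : Subgroup (SpecialLinearGroup (Fin 3) ℝ))
    (hH₂ : ∀ g : SpecialLinearGroup (Fin 3) ℝ, g ∈ H₂ ↔ ∃ t a b : ℝ,
      (g : Matrix (Fin 3) (Fin 3) ℝ) =
        !![d ^ (-(2 * t)), a, b;
           0, d ^ t * Real.cos t, d ^ t * Real.sin t;
           0, -(d ^ t * Real.sin t), d ^ t * Real.cos t]) :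
    ¬ ∃ σ : (SpecialLinearGroup (Fin 3) ℝ ⧸ H₂) → SpecialLinearGroup (Fin 3) ℝ,
      (∀ g : SpecialLinearGroup (Fin 3) ℝ,
        (QuotientGroup.mk (σ (QuotientGroup.mk g)) : SpecialLinearGroup (Fin 3) ℝ ⧸ H₂) =
          QuotientGroup.mk g) ∧
      {A : SpecialLinearGroup (Fin 3) ℝ |
        (A : Matrix (Fin 3) (Fin 3) ℝ).IsSymm ∧ (A : Matrix (Fin 3) (Fin 3) ℝ).PosDef} ⊆
        Set.range σ := by
  rintro ⟨σ, hσ, hrange⟩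
  have hσ' : ∀ x, (QuotientGroup.mk (σ x) : SpecialLinearGroup (Fin 3) ℝ ⧸ H₂) = x := by
    intro x
    induction x using QuotientGroup.induction_on with
    | H g => exact hσ g
  have hd0 : 0 < d := by linarith
  set D : ℝ := d ^ (2 * π) with hD
  set E : ℝ := d ^ (-(2 * (2 * π))) with hE
  have hD0 : 0 < D := Real.rpow_pos_of_pos hd0 _
  have hE0 : 0 < E := Real.rpow_pos_of_pos hd0 _
  have hD1 : 1 < D := Real.one_lt_rpow hd (by positivity)
  have hdet : E * D * D = 1 := by
    rw [hD, hE, ← Real.rpow_add hd0, ← Real.rpow_add hd0]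
    ring_nf
    simp
  let h : SpecialLinearGroup (Fin 3) ℝ :=
    ⟨diagonal ![E, D, D], by simpa [det_diagonal, Fin.prod_univ_three] using hdet⟩
  have hh : h ∈ H₂ := by
    refine (hH₂ h).2 ⟨2 * π, 0, 0, ?_⟩
    simp only [Real.cos_two_pi, Real.sin_two_pi, ← hD, ← hE]
    ext i j
    fin_cases i <;> fin_cases j <;> simp [h]
  have hpos : (diagonal ![E, D, D]).PosDef := by
    refine PosDef.diagonal fun i => ?_
    fin_cases i <;> simp [hD0, hE0]
  obtain ⟨x, hx⟩ := hrange (show (1 : SpecialLinearGroup (Fin 3) ℝ) ∈ _ from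
    ⟨by simp [IsSymm], by simpa using PosDef.one⟩)
  obtain ⟨y, hy⟩ := hrange (show h ∈ _ from ⟨isSymm_diagonal _, hpos⟩)
  have hxy : x = y := by
    rw [← hσ' x, ← hσ' y, hx, hy, QuotientGroup.eq]
    simpa using hh
  have h1 : (1 : SpecialLinearGroup (Fin 3) ℝ) = h := by rw [← hx, ← hy, hxy]
  have h11 := congrArg (fun g : SpecialLinearGroup (Fin 3) ℝ =>
    (g : Matrix (Fin 3) (Fin 3) ℝ) 1 1) h1
  simp [h] at h11
  linarith
end

section
/- Let H₃ be the subgroup of SL₃(ℝ) of all upper unitriangular matrices [[1,k,l],[0,1,m],[0,0,1]] with k, l, m ∈ ℝ. For every real c > −1 set g_c = [[1+c,1,0],[c,1,0],[0,0,1]] and s₃(c) = [[1+c, c, 0],[c, (c²+1)/(1+c), 0],[0,0,1]]. Then the set of symmetric positive-definite determinant-1 matrices contained in the left coset g_c·H₃ is exactly {s₃(c)}. -/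
open Matrix

/-- The representative `s₃(c)` is positive definite: complete the square. -/
theorem posDef_coset_representative {c : ℝ} (hc : -1 < c) :
    (!![1 + c, c, 0; c, (c ^ 2 + 1) / (1 + c), 0; 0, 0, 1] :
      Matrix (Fin 3) (Fin 3) ℝ).PosDef := by
  have hpos : 0 < 1 + c := by linarith
  refine PosDef.of_dotProduct_mulVec_pos ?_ fun x hx => ?_
  · ext i j
    fin_cases i <;> fin_cases j <;> simp
  · have key : star x ⬝ᵥ
        (!![1 + c, c, 0; c, (c ^ 2 + 1) / (1 + c), 0; 0, 0, 1] *ᵥ x) =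
        (((1 + c) * x 0 + c * x 1) ^ 2 + x 1 ^ 2) / (1 + c) + x 2 ^ 2 := by
      simp [dotProduct, mulVec, Fin.sum_univ_three]
      field_simp
      ring
    rw [key]
    by_cases h2 : x 2 = 0
    · by_cases h1 : x 1 = 0
      · have h0 : x 0 ≠ 0 := by
          intro h0
          apply hx
          ext i
          fin_cases i <;> simp [h0, h1, h2]
        rw [h1, h2]
        have : (1 + c) * x 0 + c * 0 ≠ 0 := by simp [h0, hpos.ne']
        positivity
      · positivity
    · positivity

/-- Intermediate computation in the proof of Proposition 12: for `c > -1` the set of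
symmetric positive-definite determinant-`1` matrices in the left coset `g_c·H₃` of the
unitriangular subgroup `H₃` of `SL₃(ℝ)` is exactly `{s₃(c)}`. -/
theorem coset_H3_meets_posdef_in_one_point (c : ℝ) (hc : -1 < c) :
    {A : Matrix (Fin 3) (Fin 3) ℝ | A.IsSymm ∧ A.PosDef ∧ A.det = 1 ∧
      ∃ k l m : ℝ, A = !![1 + c, 1, 0; c, 1, 0; 0, 0, 1] * !![1, k, l; 0, 1, m; 0, 0, 1]} =
    {!![1 + c, c, 0; c, (c ^ 2 + 1) / (1 + c), 0; 0, 0, 1]} := by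
  have hne : 1 + c ≠ 0 := by linarith
  ext A
  simp only [Set.mem_ofPred_eq, Set.mem_singleton_iff]
  constructor
  · rintro ⟨hsymm, -, -, k, l, m, rfl⟩
    have h01 := hsymm.apply 0 1
    have h02 := hsymm.apply 0 2
    have h12 := hsymm.apply 1 2
    simp [Matrix.mul_apply, Fin.sum_univ_three] at h01 h02 h12
    have hl : l = 0 := by linarith
    have hm : m = 0 := by simpa [hl] using h12.symm
    have hk : k = (c - 1) / (1 + c) := by
      rw [eq_div_iff hne]
      linarith
    subst hl hm hk
    ext i j
    fin_cases i <;> fin_cases j <;> simp [Matrix.mul_apply, Fin.sum_univ_three] <;>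
      field_simp <;> ring
  · rintro rfl
    refine ⟨?_, posDef_coset_representative hc, ?_, (c - 1) / (1 + c), 0, 0, ?_⟩
    · ext i j
      fin_cases i <;> fin_cases j <;> simp
    · simp [det_fin_three]
      field_simp
      ring
    · ext i j
      fin_cases i <;> fin_cases j <;> simp [Matrix.mul_apply, Fin.sum_univ_three] <;>
        field_simp <;> ring
end

section
/- Let H₃ be the subgroup of SL₃(ℝ) of all upper unitriangular matrices [[1,k,l],[0,1,m],[0,0,1]] with k, l, m ∈ ℝ. Then there is no continuous section σ : SL₃(ℝ)/H₃ → SL₃(ℝ) (i.e. continuous with σ(gH₃) ∈ gH₃ for all g) whose image contains the set of all symmetric positive-definite real 3×3 matrices of determinant 1. -/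
open Matrix

/-- `SL₃(ℝ)` carries the subspace topology induced from the space of matrices. -/
noncomputable instance : TopologicalSpace (SpecialLinearGroup (Fin 3) ℝ) :=
  TopologicalSpace.induced (fun g => (g : Matrix (Fin 3) (Fin 3) ℝ)) inferInstance

/-- A path in `SL₃(ℝ)` which is continuous on all of `ℝ`, and which for `t > 0` stays in the
cosets of the positive-definite matrices `posDefPath t`. -/
def cosetPath (t : ℝ) : SpecialLinearGroup (Fin 3) ℝ :=
  ⟨!![t, -1, 0; 1, 0, 0; 0, 0, 1], by simp [det_fin_three]⟩

/-- Symmetric matrices of determinant `1`, positive definite for `t > 0` and unbounded as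
`t → 0`. -/
noncomputable def posDefPath (t : ℝ) (ht : 0 < t) : SpecialLinearGroup (Fin 3) ℝ :=
  ⟨!![t, 1, 0; 1, 2 / t, 0; 0, 0, 1], by simp [det_fin_three]; field_simp; norm_num⟩

lemma continuous_cosetPath : Continuous cosetPath := by
  refine continuous_induced_rng.2 (continuous_matrix fun i j => ?_)
  fin_cases i <;> fin_cases j <;> simp <;> fun_prop

lemma isSymm_posDefPath (t : ℝ) (ht : 0 < t) :
    (posDefPath t ht : Matrix (Fin 3) (Fin 3) ℝ).IsSymm := by
  ext i j
  fin_cases i <;> fin_cases j <;> simp [posDefPath]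

lemma posDef_posDefPath (t : ℝ) (ht : 0 < t) :
    (posDefPath t ht : Matrix (Fin 3) (Fin 3) ℝ).PosDef := by
  refine PosDef.of_dotProduct_mulVec_pos
    (by simpa [IsHermitian, IsSymm] using isSymm_posDefPath t ht) fun x hx => ?_
  have key : star x ⬝ᵥ ((posDefPath t ht : Matrix (Fin 3) (Fin 3) ℝ) *ᵥ x) =
      ((t * x 0 + x 1) ^ 2 + x 1 ^ 2) / t + x 2 ^ 2 := by
    simp [posDefPath, dotProduct, mulVec, Fin.sum_univ_three]
    field_simp
    ring
  rw [key]
  by_cases h1 : x 1 = 0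
  · by_cases h2 : x 2 = 0
    · have h0 : x 0 ≠ 0 := fun h0 => hx (by ext i; fin_cases i <;> simp [h0, h1, h2])
      rw [h1, h2, mul_comm]
      have : 0 < x 0 ^ 2 := by positivity
      simp only [add_zero, ne_eq, OfNat.ofNat_ne_zero, not_false_eq_true, zero_pow]
      positivity
    · positivity
  · positivity

lemma posDefPath_eq_cosetPath_mul (t : ℝ) (ht : 0 < t) :
    posDefPath t ht = cosetPath t *
      ⟨!![1, 2 / t, 0; 0, 1, 0; 0, 0, 1], by simp [det_fin_three]⟩ := by
  refine Subtype.ext ?_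
  change !![t, 1, 0; 1, 2 / t, 0; 0, 0, 1] =
    !![t, -1, 0; 1, 0, 0; 0, 0, 1] * !![1, 2 / t, 0; 0, 1, 0; 0, 0, 1]
  ext i j
  fin_cases i <;> fin_cases j <;> simp [Matrix.mul_apply, Fin.sum_univ_three]
  · field_simp
    norm_num

/-- Proposition 12, part `H₃`: there is no continuous section of `SL₃(ℝ)` by the
unitriangular subgroup `H₃` whose image contains all symmetric positive-definite
determinant-`1` matrices. -/
theorem no_continuous_section_H3
    (H₃ : Subgroup (SpecialLinearGroup (Fin 3) ℝ))
    (hH₃ : ∀ g : SpecialLinearGroup (Fin 3) ℝ, g ∈ H₃ ↔ ∃ k l m : ℝ,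
      (g : Matrix (Fin 3) (Fin 3) ℝ) = !![1, k, l; 0, 1, m; 0, 0, 1]) :
    ¬ ∃ σ : (SpecialLinearGroup (Fin 3) ℝ ⧸ H₃) → SpecialLinearGroup (Fin 3) ℝ,
      Continuous σ ∧
      (∀ g : SpecialLinearGroup (Fin 3) ℝ,
        (QuotientGroup.mk (σ (QuotientGroup.mk g)) : SpecialLinearGroup (Fin 3) ℝ ⧸ H₃) =
          QuotientGroup.mk g) ∧
      {A : SpecialLinearGroup (Fin 3) ℝ |
        (A : Matrix (Fin 3) (Fin 3) ℝ).IsSymm ∧ (A : Matrix (Fin 3) (Fin 3) ℝ).PosDef} ⊆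
        Set.range σ := by
  rintro ⟨σ, hσ, hsec, hrange⟩
  have hval : ∀ (t : ℝ) (ht : 0 < t), σ (cosetPath t) = posDefPath t ht := by
    intro t ht
    obtain ⟨x, hx⟩ := hrange ⟨isSymm_posDefPath t ht, posDef_posDefPath t ht⟩
    obtain ⟨g, rfl⟩ := QuotientGroup.mk_surjective x
    have hmk : (cosetPath t : SpecialLinearGroup (Fin 3) ℝ ⧸ H₃) = posDefPath t ht := by
      rw [posDefPath_eq_cosetPath_mul]
      exact (QuotientGroup.mk_mul_of_mem _ ((hH₃ _).2 ⟨2 / t, 0, 0, rfl⟩)).symm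
    rw [hmk, ← hx, hsec g]
  have hcont : Continuous fun t : ℝ =>
      t * (σ (cosetPath t) : Matrix (Fin 3) (Fin 3) ℝ) 1 1 := by
    have h : Continuous fun t : ℝ => (σ (cosetPath t) : Matrix (Fin 3) (Fin 3) ℝ) :=
      continuous_induced_dom.comp
        (hσ.comp (continuous_quot_mk.comp continuous_cosetPath))
    exact continuous_id.mul (h.matrix_elem 1 1)
  have hlim := (hcont.tendsto 0).mono_left (nhdsWithin_le_nhds (s := Set.Ioi 0))
  have hconst : Filter.Tendsto
      (fun t : ℝ => t * (σ (cosetPath t) : Matrix (Fin 3) (Fin 3) ℝ) 1 1)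
      (nhdsWithin 0 (Set.Ioi 0)) (nhds 2) := by
    refine tendsto_const_nhds.congr' ?_
    filter_upwards [self_mem_nhdsWithin] with t ht
    have ht : 0 < t := ht
    rw [hval t ht]
    simp [posDefPath]
    field_simp
  have := tendsto_nhds_unique hlim hconst
  simp at this
end
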